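/- arXiv:0910.4551 — 2 statements merged into one kernel-verified Lean document; each statement's English description precedes it below -/
import Mathlib

section
/- Let H ⊂ ℂ be a rectangle, let τ be a finite positive Borel measure on H, let φ > 0 be continuous on H, set S := −log φ, and let μ be a Borel probability measure on H. Then inf_{k,ε} limsup_{d→∞} (1/d²) log J^φ_d(μ,k,ε) ≤ Σ(μ) − 2∫_H S dμ, where the infimum is over all k ∈ ℕ and ε > 0 and both sides take values in [−∞, ∞). -/
open MeasureTheory Filter Set
open scoped ENNReal NNReal Topology BigOperators

noncomputable section

/-- Extended logarithm on `ℝ≥0∞`, with `elog 0 = ⊥` and `elog ⊤ = ⊤`. -/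
def elog (x : ℝ≥0∞) : EReal :=
  if x = 0 then ⊥ else if x = ⊤ then ⊤ else ((Real.log x.toReal : ℝ) : EReal)

/-- The empirical measure `κ_d(λ) = (1/d) ∑_j δ_{λ_j}`. -/
def empMeasure (d : ℕ) (l : Fin d → ℂ) : MeasureTheory.Measure ℂ :=
  (d : ℝ≥0∞)⁻¹ • ∑ j : Fin d, MeasureTheory.Measure.dirac (l j)

/-- The weak* moment neighborhood `G(μ,k,ε)`: Borel probability measures on `E` whose
real moments of total order `≤ k` are within `ε` of those of `μ`. -/
def momentNbhd (E : Set ℂ) (μ : MeasureTheory.Measure ℂ) (k : ℕ) (ε : ℝ) :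
    Set (MeasureTheory.Measure ℂ) :=
  {ν | MeasureTheory.IsProbabilityMeasure ν ∧ ν Eᶜ = 0 ∧
    ∀ n₁ n₂ : ℕ, n₁ + n₂ ≤ k →
      |(∫ z, z.re ^ n₁ * z.im ^ n₂ ∂μ) - ∫ z, z.re ^ n₁ * z.im ^ n₂ ∂ν| < ε}

/-- `G̃_d(μ,k,ε) = {λ ∈ E^d : κ_d(λ) ∈ G(μ,k,ε)}`. -/
def GT (E : Set ℂ) (d : ℕ) (μ : MeasureTheory.Measure ℂ) (k : ℕ) (ε : ℝ) :
    Set (Fin d → ℂ) :=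
  {l | (∀ j, l j ∈ E) ∧ empMeasure d l ∈ momentNbhd E μ k ε}

/-- The VanDerMonde determinant `VDM_d(λ) = ∏_{i<j} (λ_i - λ_j)`. -/
def vdm (d : ℕ) (l : Fin d → ℂ) : ℂ :=
  ∏ i : Fin d, ∏ j ∈ Finset.Ioi i, (l i - l j)

/-- The weighted VanDerMonde `VDM^w_d(λ) = VDM_d(λ) ∏_i w(λ_i)^d`. -/
def vdmW (w : ℂ → ℝ) (d : ℕ) (l : Fin d → ℂ) : ℂ :=
  vdm d l * ∏ i : Fin d, (w (l i) : ℂ) ^ d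

/-- A (compact, axis-parallel, nondegenerate) rectangle in `ℂ ≅ ℝ²`. -/
def IsRectangle (H : Set ℂ) : Prop :=
  ∃ a b c e : ℝ, a < b ∧ c < e ∧
    H = {z : ℂ | z.re ∈ Set.Icc a b ∧ z.im ∈ Set.Icc c e}

/-- The free entropy `Σ(μ) = ∫∫ log|z-t| dμ(z)dμ(t)`, with values in `[-∞,∞)` for
compactly supported `μ` (positive part minus negative part, as an extended real). -/
def freeEntropy (μ : MeasureTheory.Measure ℂ) : EReal :=
  (((∫⁻ p : ℂ × ℂ, ENNReal.ofReal (Real.log ‖p.1 - p.2‖) ∂(μ.prod μ)).toReal : ℝ) : EReal)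
    - ((∫⁻ p : ℂ × ℂ, ENNReal.ofReal (-Real.log ‖p.1 - p.2‖) ∂(μ.prod μ) : ℝ≥0∞) : EReal)

/-- The density condition (3.10): `τ(D(z₀,r)) ≥ r^T` for all `z₀ ∈ E` and `0 < r ≤ r₀`. -/
def DensityCond (E : Set ℂ) (τ : MeasureTheory.Measure ℂ) : Prop :=
  ∃ T : ℝ, 0 < T ∧ ∃ r₀ : ℝ, 0 < r₀ ∧ ∀ z₀ ∈ E, ∀ r : ℝ, 0 < r → r ≤ r₀ →
    ENNReal.ofReal (r ^ T) ≤ τ (Metric.closedBall z₀ r)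

/-- `J^φ_d(μ,k,ε) = ∫_{G̃_d(μ,k,ε)} |VDM^φ_d(λ)|² dτ(λ₁)⋯dτ(λ_d)`. -/
def Jint (H : Set ℂ) (τ : MeasureTheory.Measure ℂ) (φ : ℂ → ℝ)
    (μ : MeasureTheory.Measure ℂ) (k : ℕ) (ε : ℝ) (d : ℕ) : ℝ≥0∞ :=
  ∫⁻ l in GT H d μ k ε, ENNReal.ofReal (‖vdmW φ d l‖ ^ 2)
    ∂(MeasureTheory.Measure.pi fun _ : Fin d => τ)

/-- The sup norm `‖p‖_H` of a two-variable real polynomial over `H ⊂ ℂ ≅ ℝ²`. -/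
def supOn (H : Set ℂ) (p : MvPolynomial (Fin 2) ℝ) : ℝ :=
  sSup ((fun z : ℂ => |MvPolynomial.eval ![z.re, z.im] p|) '' H)

/-- The Euclidean norm of the gradient of a two-variable real polynomial at `z ∈ ℂ ≅ ℝ²`. -/
def gradNorm (p : MvPolynomial (Fin 2) ℝ) (z : ℂ) : ℝ :=
  Real.sqrt ((MvPolynomial.eval ![z.re, z.im] (MvPolynomial.pderiv 0 p)) ^ 2 +
    (MvPolynomial.eval ![z.re, z.im] (MvPolynomial.pderiv 1 p)) ^ 2)

/-- Evaluation of a polynomial in `2d` real variables at a point of `ℂ^d ≅ (ℝ²)^d`. -/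
def evalPt (d : ℕ) (P : MvPolynomial (Fin d × Fin 2) ℝ) (l : Fin d → ℂ) : ℝ :=
  MvPolynomial.eval (fun q : Fin d × Fin 2 => ![(l q.1).re, (l q.1).im] q.2) P

/-- The filter on measures generated by the moment neighborhoods of `μ`. -/
def momentFilter (H : Set ℂ) (μ : Measure ℂ) : Filter (Measure ℂ) :=
  ⨅ k : ℕ, 𝓟 (momentNbhd H μ k (1 / ((k : ℝ) + 1)))

theorem momentFilter_hasBasis (H : Set ℂ) (μ : Measure ℂ) :
    (momentFilter H μ).HasBasis (fun _ => True)
      fun k : ℕ => momentNbhd H μ k (1 / ((k : ℝ) + 1)) := by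
  apply hasBasis_iInf_principal
  apply directed_of_isDirected_le
  intro k m hkm ν hν
  refine ⟨hν.1, hν.2.1, fun n₁ n₂ h => (hν.2.2 n₁ n₂ (h.trans hkm)).trans_le ?_⟩
  gcongr

theorem tendsto_moment (H : Set ℂ) (μ : Measure ℂ) (n₁ n₂ : ℕ) :
    Tendsto (fun ν : Measure ℂ => ∫ z, z.re ^ n₁ * z.im ^ n₂ ∂ν) (momentFilter H μ)
      (𝓝 (∫ z, z.re ^ n₁ * z.im ^ n₂ ∂μ)) := by
  rw [Metric.tendsto_nhds]
  intro δ hδ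
  obtain ⟨m, hm⟩ := exists_nat_one_div_lt hδ
  refine (momentFilter_hasBasis H μ).mem_iff.2 ⟨max m (n₁ + n₂), trivial, fun ν hν => ?_⟩
  have h := hν.2.2 n₁ n₂ (le_max_right _ _)
  rw [abs_sub_comm] at h
  refine h.trans (lt_of_le_of_lt ?_ hm)
  gcongr
  exact le_max_left _ _

theorem eventually_momentFilter (H : Set ℂ) (μ : Measure ℂ) :
    ∀ᶠ ν in momentFilter H μ, IsProbabilityMeasure ν ∧ ν Hᶜ = 0 :=
  (momentFilter_hasBasis H μ).mem_iff.2 ⟨0, trivial, fun _ hν => ⟨hν.1, hν.2.1⟩⟩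

theorem ae_prod_mem {H : Set ℂ} {ν : Measure ℂ} [SFinite ν] (hν : ν Hᶜ = 0) :
    ∀ᵐ p ∂(ν.prod ν), p ∈ H ×ˢ H := by
  have h : ∀ᵐ z ∂ν, z ∈ H := hν
  filter_upwards [Measure.quasiMeasurePreserving_fst.ae h,
    Measure.quasiMeasurePreserving_snd.ae h] with p h₁ h₂
  exact ⟨h₁, h₂⟩

theorem integrable_prod_of_continuous {H : Set ℂ} (hH : IsCompact H) {ν : Measure ℂ}
    [IsFiniteMeasure ν] (hν : ν Hᶜ = 0) {f : ℂ × ℂ → ℝ} (hf : Continuous f) :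
    Integrable f (ν.prod ν) := by
  rw [← Measure.restrict_eq_self_of_ae_mem (ae_prod_mem hν)]
  exact hf.continuousOn.integrableOn_compact (hH.prod hH)

/-- The four real coordinates on `ℂ × ℂ`. -/
def coords : Fin 4 → C(ℂ × ℂ, ℝ) :=
  ![⟨fun p => p.1.re, by fun_prop⟩, ⟨fun p => p.1.im, by fun_prop⟩,
    ⟨fun p => p.2.re, by fun_prop⟩, ⟨fun p => p.2.im, by fun_prop⟩]

theorem aeval_coords_apply (P : MvPolynomial (Fin 4) ℝ) (p : ℂ × ℂ) :
    MvPolynomial.aeval coords P p =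
      ∑ s ∈ P.support, P.coeff s *
        ((p.1.re ^ s 0 * p.1.im ^ s 1) * (p.2.re ^ s 2 * p.2.im ^ s 3)) := by
  rw [MvPolynomial.aeval_def, MvPolynomial.eval₂_eq']
  simp [ContinuousMap.sum_apply, Fin.prod_univ_four, coords, mul_assoc]

theorem separatesPoints_coords :
    (MvPolynomial.aeval (R := ℝ) coords).range.SeparatesPoints := by
  intro p q hpq
  by_contra! h
  have hc : ∀ i, coords i p = coords i q := fun i =>
    h _ ⟨coords i, ⟨MvPolynomial.X i, by simp⟩, rfl⟩
  refine hpq (Prod.ext (Complex.ext ?_ ?_) (Complex.ext ?_ ?_))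
  exacts [hc 0, hc 1, hc 2, hc 3]

theorem integral_aeval_coords {H : Set ℂ} (hH : IsCompact H) {ν : Measure ℂ}
    [IsFiniteMeasure ν] (hν : ν Hᶜ = 0) (P : MvPolynomial (Fin 4) ℝ) :
    ∫ p, MvPolynomial.aeval coords P p ∂(ν.prod ν) =
      ∑ s ∈ P.support, P.coeff s *
        ((∫ z, z.re ^ s 0 * z.im ^ s 1 ∂ν) * ∫ z, z.re ^ s 2 * z.im ^ s 3 ∂ν) := by
  simp_rw [aeval_coords_apply]
  rw [integral_finsetSum _ fun s _ => integrable_prod_of_continuous hH hν (by fun_prop)]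
  refine Finset.sum_congr rfl fun s _ => ?_
  rw [integral_const_mul]
  congr 1
  exact integral_prod_mul (μ := ν) (ν := ν) (fun z : ℂ => z.re ^ s 0 * z.im ^ s 1)
    (fun z : ℂ => z.re ^ s 2 * z.im ^ s 3)

theorem abs_integral_prod_sub_le {H : Set ℂ} (hH : IsCompact H) {ν : Measure ℂ}
    [IsProbabilityMeasure ν] (hν : ν Hᶜ = 0) {f g : ℂ × ℂ → ℝ} (hf : Continuous f)
    (hg : Continuous g) {δ : ℝ} (h : ∀ p ∈ H ×ˢ H, ‖g p - f p‖ < δ) :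
    |∫ p, g p ∂(ν.prod ν) - ∫ p, f p ∂(ν.prod ν)| ≤ δ := by
  rw [← integral_sub (integrable_prod_of_continuous hH hν hg)
    (integrable_prod_of_continuous hH hν hf)]
  have := norm_integral_le_of_norm_le_const (μ := ν.prod ν) (f := fun p => g p - f p) (C := δ)
    ((ae_prod_mem hν).mono fun p hp => (h p hp).le)
  simpa using this

/-- Double integrals of continuous functions are continuous for convergence of moments. -/
theorem tendsto_integral_prod {H : Set ℂ} (hH : IsCompact H) (μ : Measure ℂ)
    [IsProbabilityMeasure μ] (hμ : μ Hᶜ = 0) {f : ℂ × ℂ → ℝ} (hf : Continuous f) :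
    Tendsto (fun ν : Measure ℂ => ∫ p, f p ∂(ν.prod ν)) (momentFilter H μ)
      (𝓝 (∫ p, f p ∂(μ.prod μ))) := by
  rw [Metric.tendsto_nhds]
  intro δ hδ
  obtain ⟨g, ⟨P, rfl⟩, hP⟩ :=
    ContinuousMap.exists_mem_subalgebra_near_continuous_of_isCompact_of_separatesPoints
      separatesPoints_coords ⟨f, hf⟩ (hH.prod hH) (show 0 < δ / 3 by positivity)
  have hlim : Tendsto (fun ν : Measure ℂ => ∑ s ∈ P.support, P.coeff s *
      ((∫ z, z.re ^ s 0 * z.im ^ s 1 ∂ν) * ∫ z, z.re ^ s 2 * z.im ^ s 3 ∂ν)) (momentFilter H μ)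
      (𝓝 (∑ s ∈ P.support, P.coeff s *
        ((∫ z, z.re ^ s 0 * z.im ^ s 1 ∂μ) * ∫ z, z.re ^ s 2 * z.im ^ s 3 ∂μ))) :=
    tendsto_finsetSum _ fun s _ =>
      ((tendsto_moment H μ _ _).mul (tendsto_moment H μ _ _)).const_mul _
  filter_upwards [Metric.tendsto_nhds.1 hlim (δ / 3) (by positivity),
    eventually_momentFilter H μ] with ν hν hνp
  obtain ⟨hν₁, hν₂⟩ := hνp
  rw [← integral_aeval_coords hH hν₂, ← integral_aeval_coords hH hμ, Real.dist_eq] at hν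
  rw [Real.dist_eq]
  have h₁ := abs_le.1 (abs_integral_prod_sub_le hH hν₂ hf
    (MvPolynomial.aeval coords P).continuous hP)
  have h₂ := abs_le.1 (abs_integral_prod_sub_le hH hμ hf
    (MvPolynomial.aeval coords P).continuous hP)
  rw [abs_lt] at hν ⊢
  constructor <;> linarith [h₁.1, h₁.2, h₂.1, h₂.2]

/-- The logarithmic kernel truncated from below at `-M`. -/
def truncLog (M : ℝ) (z t : ℂ) : ℝ := Real.log (max ‖z - t‖ (Real.exp (-M)))

theorem truncLog_self (M : ℝ) (z : ℂ) : truncLog M z z = -M := by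
  simp [truncLog, max_eq_right (Real.exp_pos _).le]

theorem truncLog_comm (M : ℝ) (z t : ℂ) : truncLog M z t = truncLog M t z := by
  simp [truncLog, norm_sub_rev]

theorem norm_sub_le_exp_truncLog (M : ℝ) (z t : ℂ) : ‖z - t‖ ≤ Real.exp (truncLog M z t) := by
  rw [truncLog, Real.exp_log (lt_max_of_lt_right (Real.exp_pos _))]
  exact le_max_left _ _

theorem continuous_truncLog (M : ℝ) : Continuous fun p : ℂ × ℂ => truncLog M p.1 p.2 := by
  refine Continuous.log (by fun_prop) fun p => ?_
  exact (lt_max_of_lt_right (Real.exp_pos _)).ne'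

theorem continuous_truncLog_add (M : ℝ) {ψ : ℂ → ℝ} (hψ : Continuous ψ) :
    Continuous fun p : ℂ × ℂ => truncLog M p.1 p.2 + ψ p.1 + ψ p.2 :=
  ((continuous_truncLog M).add (hψ.comp continuous_fst)).add (hψ.comp continuous_snd)

theorem truncLog_le {M : ℝ} (hM : 0 ≤ M) (z t : ℂ) :
    truncLog M z t ≤ max (Real.log ‖z - t‖) 0 - min (max (-Real.log ‖z - t‖) 0) M := by
  rcases eq_or_ne z t with rfl | h
  · simp [truncLog_self, hM]
  · have h0 : 0 < ‖z - t‖ := norm_pos_iff.2 (sub_ne_zero.2 h)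
    have : truncLog M z t = max (Real.log ‖z - t‖) (-M) := by
      rw [truncLog]
      rcases le_total ‖z - t‖ (Real.exp (-M)) with h' | h'
      · rw [max_eq_right h', Real.log_exp, max_eq_right]
        rwa [Real.log_le_iff_le_exp h0]
      · rw [max_eq_left h', max_eq_left]
        rwa [Real.le_log_iff_exp_le h0]
    rw [this]
    grind

theorem norm_vdmW_sq_le {φ ψ : ℂ → ℝ} {d : ℕ} {l : Fin d → ℂ}
    (h : ∀ i, φ (l i) = Real.exp (ψ (l i))) (M : ℝ) :
    ‖vdmW φ d l‖ ^ 2 ≤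
      Real.exp (∑ i, ∑ j, (truncLog M (l i) (l j) + ψ (l i) + ψ (l j)) + d * M) := by
  have h₁ : ‖vdmW φ d l‖ ≤ Real.exp (∑ i : Fin d, ∑ j ∈ Finset.Ioi i, truncLog M (l i) (l j) +
      ∑ i : Fin d, d * ψ (l i)) := by
    rw [vdmW, vdm, norm_mul, norm_prod, norm_prod, Real.exp_add, Real.exp_sum, Real.exp_sum]
    simp_rw [norm_prod, norm_pow, Complex.norm_real, h, Real.exp_sum, Real.norm_eq_abs,
      Real.abs_exp, Real.exp_nat_mul]
    gcongr
    exact norm_sub_le_exp_truncLog _ _ _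
  have h₂ : ∑ i : Fin d, ∑ j : Fin d, truncLog M (l i) (l j) =
      2 * ∑ i : Fin d, ∑ j ∈ Finset.Ioi i, truncLog M (l i) (l j) - d * M := by
    have := Finset.sum_sum_Ioi_add_eq_sum_sum_off_diag fun i j => truncLog M (l i) (l j)
    simp_rw [fun i j => truncLog_comm M (l j) (l i), ← two_mul, ← Finset.mul_sum] at this
    rw [this, eq_sub_iff_add_eq, ← sub_neg_eq_add, sub_eq_iff_eq_add]
    have hd : -(d * M) = ∑ i : Fin d, truncLog M (l i) (l i) := by simp [truncLog_self]
    rw [hd, ← Finset.sum_add_distrib]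
    refine Finset.sum_congr rfl fun i _ => ?_
    rw [add_comm, Fintype.sum_eq_add_sum_compl i]
  calc ‖vdmW φ d l‖ ^ 2 ≤ _ := pow_le_pow_left₀ (norm_nonneg _) h₁ 2
    _ = _ := by
      rw [← Real.exp_nat_mul]
      congr 1
      simp only [Finset.sum_add_distrib, h₂, ← Finset.mul_sum]
      simp [← Finset.mul_sum]
      ring

theorem integral_empMeasure_prod (d : ℕ) (l : Fin d → ℂ) [IsProbabilityMeasure (empMeasure d l)]
    {f : ℂ × ℂ → ℝ} (hf : Integrable f ((empMeasure d l).prod (empMeasure d l))) :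
    ∫ p, f p ∂((empMeasure d l).prod (empMeasure d l)) =
      ((d : ℝ) ^ 2)⁻¹ * ∑ i, ∑ j, f (l i, l j) := by
  have key : ∀ g : ℂ → ℝ, ∫ z, g z ∂(empMeasure d l) = (d : ℝ)⁻¹ * ∑ i, g (l i) := by
    intro g
    rw [empMeasure, integral_smul_measure, integral_finsetSum_measure]
    · simp
    · intro i _
      exact integrable_dirac (by simp)
  rw [integral_prod _ hf]
  simp_rw [key, ← Finset.mul_sum]
  ring

theorem Jint_le {H : Set ℂ} (hH : IsCompact H) (τ : Measure ℂ) [IsFiniteMeasure τ]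
    {φ ψ : ℂ → ℝ} (hψ : Continuous ψ) (h : ∀ z ∈ H, φ z = Real.exp (ψ z)) (μ : Measure ℂ)
    (M : ℝ) {k : ℕ} {ε c : ℝ}
    (hc : ∀ ν ∈ momentNbhd H μ k ε,
      ∫ p : ℂ × ℂ, (truncLog M p.1 p.2 + ψ p.1 + ψ p.2) ∂(ν.prod ν) ≤ c)
    {d : ℕ} (hd : d ≠ 0) :
    Jint H τ φ μ k ε d ≤
      ENNReal.ofReal (Real.exp (d ^ 2 * c + d * M)) * τ univ ^ d := by
  calc Jint H τ φ μ k ε d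
      ≤ ∫⁻ _ in GT H d μ k ε, ENNReal.ofReal (Real.exp (d ^ 2 * c + d * M))
          ∂(Measure.pi fun _ : Fin d => τ) := by
        refine setLIntegral_mono measurable_const fun l hl => ENNReal.ofReal_le_ofReal ?_
        refine (norm_vdmW_sq_le (fun i => h _ (hl.1 i)) M).trans (Real.exp_le_exp.2 ?_)
        gcongr
        have : IsProbabilityMeasure (empMeasure d l) := hl.2.1
        have h₁ := hc _ hl.2
        rw [integral_empMeasure_prod d l (integrable_prod_of_continuous hH hl.2.2.1
          (continuous_truncLog_add M hψ))] at h₁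
        rwa [inv_mul_le_iff₀ (by positivity)] at h₁
    _ ≤ _ := by
        rw [lintegral_const, Measure.restrict_apply_univ]
        gcongr
        refine (measure_mono (subset_univ _)).trans ?_
        simp [Measure.pi_univ]

theorem elog_mono {x y : ℝ≥0∞} (h : x ≤ y) : elog x ≤ elog y := by
  rcases eq_or_ne x 0 with rfl | hx
  · simp [elog]
  rcases eq_or_ne y ⊤ with rfl | hy
  · simp [elog]
  have hx' := ne_top_of_le_ne_top hy h
  rw [elog, elog, if_neg hx, if_neg hx', if_neg (pos_of_ne_zero hx |>.trans_le h).ne', if_neg hy,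
    EReal.coe_le_coe_iff]
  exact Real.log_le_log (ENNReal.toReal_pos hx hx') (ENNReal.toReal_mono hy h)

theorem limsup_le_of_momentNbhd {H : Set ℂ} (hH : IsCompact H) (τ : Measure ℂ)
    [IsFiniteMeasure τ] {φ ψ : ℂ → ℝ} (hψ : Continuous ψ)
    (h : ∀ z ∈ H, φ z = Real.exp (ψ z)) (μ : Measure ℂ) (M : ℝ) {k : ℕ} {ε c c' : ℝ}
    (hc : ∀ ν ∈ momentNbhd H μ k ε,
      ∫ p : ℂ × ℂ, (truncLog M p.1 p.2 + ψ p.1 + ψ p.2) ∂(ν.prod ν) ≤ c) (hcc : c < c') :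
    (Filter.atTop.limsup fun d : ℕ =>
      ((((d : ℝ) ^ 2)⁻¹ : ℝ) : EReal) * elog (Jint H τ φ μ k ε d)) ≤ c' := by
  set C : ℝ := max (τ univ).toReal 1
  have hC : 0 < C := lt_max_of_lt_right one_pos
  have hτ : τ univ ≤ ENNReal.ofReal C := by
    rw [← ENNReal.ofReal_toReal (measure_ne_top τ univ)]
    exact ENNReal.ofReal_le_ofReal (le_max_left _ _)
  have hlim : Tendsto (fun d : ℕ => c + (M + Real.log C) / d) atTop (𝓝 c) := by
    simpa using (tendsto_const_div_atTop_nhds_zero_nat (M + Real.log C)).const_add c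
  refine limsup_le_of_le (h := ?_)
  filter_upwards [hlim.eventually_lt_const hcc, eventually_ne_atTop 0] with d hd hd0
  have hJ : Jint H τ φ μ k ε d ≤
      ENNReal.ofReal (Real.exp (d ^ 2 * c + d * M + d * Real.log C)) := by
    refine (Jint_le hH τ hψ h μ M hc hd0).trans ?_
    rw [Real.exp_add _ (d * Real.log C), Real.exp_nat_mul, Real.exp_log hC,
      ENNReal.ofReal_mul (Real.exp_pos _).le, ENNReal.ofReal_pow hC.le]
    gcongr
  have hE : elog (Jint H τ φ μ k ε d) ≤
      ((d ^ 2 * c + d * M + d * Real.log C : ℝ) : EReal) := by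
    refine (elog_mono hJ).trans ?_
    rw [elog, if_neg (by simpa using Real.exp_pos _), if_neg ENNReal.ofReal_ne_top,
      ENNReal.toReal_ofReal (Real.exp_pos _).le, Real.log_exp]
  calc _ ≤ ((((d : ℝ) ^ 2)⁻¹ : ℝ) : EReal) *
        ((d ^ 2 * c + d * M + d * Real.log C : ℝ) : EReal) := by
        refine mul_le_mul_of_nonneg_left hE ?_
        exact_mod_cast (by positivity : (0 : ℝ) ≤ ((d : ℝ) ^ 2)⁻¹)
    _ ≤ c' := by
        rw [← EReal.coe_mul, EReal.coe_le_coe_iff]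
        refine le_trans (le_of_eq ?_) hd.le
        field_simp
        ring

theorem iInf_limsup_le_integral_truncLog {H : Set ℂ} (hH : IsCompact H) (τ : Measure ℂ)
    [IsFiniteMeasure τ] {φ ψ : ℂ → ℝ} (hψ : Continuous ψ)
    (h : ∀ z ∈ H, φ z = Real.exp (ψ z)) (μ : Measure ℂ) [IsProbabilityMeasure μ]
    (hμ : μ Hᶜ = 0) (M : ℝ) :
    (⨅ (k : ℕ) (ε : ℝ) (_ : 0 < ε),
        Filter.atTop.limsup fun d : ℕ =>
          ((((d : ℝ) ^ 2)⁻¹ : ℝ) : EReal) * elog (Jint H τ φ μ k ε d)) ≤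
      ((∫ p : ℂ × ℂ, (truncLog M p.1 p.2 + ψ p.1 + ψ p.2) ∂(μ.prod μ) : ℝ) : EReal) := by
  refine EReal.le_of_forall_lt_iff_le.1 fun c' hc' => ?_
  rw [EReal.coe_lt_coe_iff] at hc'
  obtain ⟨c, hc₁, hc₂⟩ := exists_between hc'
  have hlim := tendsto_integral_prod hH μ hμ (continuous_truncLog_add M hψ)
  obtain ⟨k, -, hk⟩ := (momentFilter_hasBasis H μ).mem_iff.1 (hlim.eventually_le_const hc₁)
  refine (iInf_le _ k).trans ((iInf₂_le (1 / ((k : ℝ) + 1)) (by positivity)).trans ?_)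
  exact limsup_le_of_momentNbhd hH τ hψ h μ M (fun ν hν => hk hν) hc₂

theorem lintegral_ofReal_log_ne_top {H : Set ℂ} (hH : IsCompact H) (μ : Measure ℂ)
    [IsProbabilityMeasure μ] (hμ : μ Hᶜ = 0) :
    ∫⁻ p : ℂ × ℂ, ENNReal.ofReal (Real.log ‖p.1 - p.2‖) ∂(μ.prod μ) ≠ ⊤ := by
  have hint := integrable_prod_of_continuous hH hμ
    (f := fun p : ℂ × ℂ => ‖p.1 - p.2‖) (by fun_prop)
  refine ne_top_of_le_ne_top hint.lintegral_lt_top.ne (lintegral_mono fun p => ?_)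
  exact ENNReal.ofReal_le_ofReal (Real.log_le_self (norm_nonneg _))

theorem lintegral_min_ne_top (μ : Measure ℂ) [IsProbabilityMeasure μ] (M : ℝ) :
    ∫⁻ p : ℂ × ℂ, min (ENNReal.ofReal (-Real.log ‖p.1 - p.2‖)) (ENNReal.ofReal M)
      ∂(μ.prod μ) ≠ ⊤ := by
  refine ne_top_of_le_ne_top ?_ (lintegral_mono fun p => min_le_right _ _)
  simp

theorem integral_truncLog_le {H : Set ℂ} (hH : IsCompact H) (μ : Measure ℂ)
    [IsProbabilityMeasure μ] (hμ : μ Hᶜ = 0) {M : ℝ} (hM : 0 ≤ M) :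
    ∫ p : ℂ × ℂ, truncLog M p.1 p.2 ∂(μ.prod μ) ≤
      (∫⁻ p : ℂ × ℂ, ENNReal.ofReal (Real.log ‖p.1 - p.2‖) ∂(μ.prod μ)).toReal -
      (∫⁻ p : ℂ × ℂ, min (ENNReal.ofReal (-Real.log ‖p.1 - p.2‖)) (ENNReal.ofReal M)
        ∂(μ.prod μ)).toReal := by
  have hm : Measurable fun p : ℂ × ℂ => Real.log ‖p.1 - p.2‖ := by fun_prop
  have hm₁ : Measurable fun p : ℂ × ℂ => ENNReal.ofReal (Real.log ‖p.1 - p.2‖) := by fun_prop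
  have hm₂ : Measurable fun p : ℂ × ℂ =>
    min (ENNReal.ofReal (-Real.log ‖p.1 - p.2‖)) (ENNReal.ofReal M) := by fun_prop
  have hf₂ := lintegral_min_ne_top μ M
  rw [← integral_toReal hm₁.aemeasurable (ae_lt_top hm₁ (lintegral_ofReal_log_ne_top hH μ hμ)),
    ← integral_toReal hm₂.aemeasurable (ae_lt_top hm₂ hf₂), ← integral_sub
      (integrable_toReal_of_lintegral_ne_top hm₁.aemeasurable
        (lintegral_ofReal_log_ne_top hH μ hμ))
      (integrable_toReal_of_lintegral_ne_top hm₂.aemeasurable hf₂)]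
  refine integral_mono (integrable_prod_of_continuous hH hμ (continuous_truncLog M))
    ((integrable_toReal_of_lintegral_ne_top hm₁.aemeasurable
        (lintegral_ofReal_log_ne_top hH μ hμ)).sub
      (integrable_toReal_of_lintegral_ne_top hm₂.aemeasurable hf₂)) fun p => ?_
  simpa [ENNReal.toReal_min, ENNReal.toReal_ofReal', max_eq_left hM]
    using truncLog_le hM p.1 p.2

theorem tendsto_lintegral_min (μ : Measure ℂ) [IsProbabilityMeasure μ] :
    Tendsto (fun M : ℕ => ∫⁻ p : ℂ × ℂ,
        min (ENNReal.ofReal (-Real.log ‖p.1 - p.2‖)) (ENNReal.ofReal (M : ℝ)) ∂(μ.prod μ))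
      atTop (𝓝 (∫⁻ p : ℂ × ℂ, ENNReal.ofReal (-Real.log ‖p.1 - p.2‖) ∂(μ.prod μ))) := by
  refine lintegral_tendsto_of_tendsto_of_monotone (fun n => ?_) (ae_of_all _ fun p => ?_)
    (ae_of_all _ fun p => ?_)
  · exact Measurable.aemeasurable (by fun_prop)
  · intro m n hmn
    dsimp only
    gcongr
  · refine tendsto_const_nhds.congr' ?_
    obtain ⟨N, hN⟩ := exists_nat_ge (-Real.log ‖p.1 - p.2‖)
    filter_upwards [eventually_ge_atTop N] with n hn
    rw [min_eq_left]
    exact ENNReal.ofReal_le_ofReal (hN.trans (by exact_mod_cast hn))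

theorem IsRectangle.isCompact {H : Set ℂ} (hH : IsRectangle H) : IsCompact H := by
  obtain ⟨a, b, c, e, -, -, rfl⟩ := hH
  exact isCompact_Icc.reProdIm isCompact_Icc

/-- the upper bound (a) in Theorem 3.1. -/
theorem energy_upper_bound (H : Set ℂ) (hH : IsRectangle H)
    (τ : MeasureTheory.Measure ℂ) [MeasureTheory.IsFiniteMeasure τ] (hτH : τ Hᶜ = 0)
    (φ : ℂ → ℝ) (hφ : ContinuousOn φ H) (hφpos : ∀ z ∈ H, 0 < φ z)
    (μ : MeasureTheory.Measure ℂ) [MeasureTheory.IsProbabilityMeasure μ] (hμH : μ Hᶜ = 0) :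
    (⨅ (k : ℕ) (ε : ℝ) (_ : 0 < ε),
        Filter.atTop.limsup fun d : ℕ =>
          ((((d : ℝ) ^ 2)⁻¹ : ℝ) : EReal) * elog (Jint H τ φ μ k ε d)) ≤
      freeEntropy μ - ((2 * ∫ z in H, -Real.log (φ z) ∂μ : ℝ) : EReal) := by
  have hK := hH.isCompact
  have hlog : ContinuousOn (fun z => Real.log (φ z)) H :=
    hφ.log fun z hz => (hφpos z hz).ne'
  obtain ⟨ψ, hψ⟩ := ContinuousMap.exists_restrict_eq hK.isClosed
    ⟨H.domRestrict fun z => Real.log (φ z), continuousOn_iff_continuous_domRestrict.1 hlog⟩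
  have hψlog : ∀ z ∈ H, ψ z = Real.log (φ z) := fun z hz => DFunLike.congr_fun hψ ⟨z, hz⟩
  have hψφ : ∀ z ∈ H, φ z = Real.exp (ψ z) := fun z hz => by
    rw [hψlog z hz, Real.exp_log (hφpos z hz)]
  have hint : ∫ z in H, -Real.log (φ z) ∂μ = -∫ z, ψ z ∂μ := by
    rw [integral_neg, setIntegral_congr_fun hK.measurableSet fun z hz => (hψlog z hz).symm,
      Measure.restrict_eq_self_of_ae_mem (s := H) hμH]
  have hlim : Tendsto (fun M : ℕ => ((2 * ∫ z, ψ z ∂μ + (∫⁻ p : ℂ × ℂ,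
      ENNReal.ofReal (Real.log ‖p.1 - p.2‖) ∂(μ.prod μ)).toReal : ℝ) : EReal) +
      -((∫⁻ p : ℂ × ℂ, min (ENNReal.ofReal (-Real.log ‖p.1 - p.2‖)) (ENNReal.ofReal (M : ℝ))
        ∂(μ.prod μ) : ℝ≥0∞) : EReal)) atTop
      (𝓝 (freeEntropy μ - ((2 * ∫ z in H, -Real.log (φ z) ∂μ : ℝ) : EReal))) := by
    rw [hint, freeEntropy, sub_eq_add_neg, sub_eq_add_neg, ← EReal.coe_neg]
    simp only [mul_neg, neg_neg, EReal.coe_add]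
    rw [add_comm _ ((2 * ∫ z, ψ z ∂μ : ℝ) : EReal), ← add_assoc, ← EReal.coe_add]
    exact (EReal.continuousAt_add (p := (((2 * ∫ z, ψ z ∂μ + (∫⁻ p : ℂ × ℂ,
      ENNReal.ofReal (Real.log ‖p.1 - p.2‖) ∂(μ.prod μ)).toReal : ℝ) : EReal),
      -((∫⁻ p : ℂ × ℂ, ENNReal.ofReal (-Real.log ‖p.1 - p.2‖) ∂(μ.prod μ) : ℝ≥0∞) : EReal)))
      (Or.inl (EReal.coe_ne_top _)) (Or.inl (EReal.coe_ne_bot _))).tendsto.comp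
        (tendsto_const_nhds.prodMk_nhds ((continuous_neg.tendsto _).comp
          ((continuous_coe_ennreal_ereal.tendsto _).comp (tendsto_lintegral_min μ))))
  refine ge_of_tendsto' hlim fun M => ?_
  refine (iInf_limsup_le_integral_truncLog hK τ ψ.continuous hψφ μ hμH M).trans ?_
  have hi {f : ℂ × ℂ → ℝ} (hf : Continuous f) := integrable_prod_of_continuous hK hμH hf
  have h₁ := integral_truncLog_le hK μ hμH (Nat.cast_nonneg (α := ℝ) M)
  rw [← EReal.coe_ennreal_toReal (lintegral_min_ne_top μ M), ← EReal.coe_neg, ← EReal.coe_add, EReal.coe_le_coe_iff,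
    integral_add (f := fun p : ℂ × ℂ => truncLog M p.1 p.2 + ψ p.1)
      (hi ((continuous_truncLog M).add (by fun_prop))) (hi (by fun_prop)),
    integral_add (hi (continuous_truncLog M)) (hi (by fun_prop)),
    integral_fun_fst (f := ψ), integral_fun_snd (f := ψ)]
  simp only [probReal_univ, one_smul]
  linarith

end
end

section
/- Let E ⊂ ℂ be compact, and for each d let λ^d = (λ^d_1,…,λ^d_d) ∈ E^d be such that the empirical measures κ_d(λ^d) converge weak* to a Borel probability measure μ on E. Then limsup_{d→∞} (1/d²) Σ_{j ≠ k} log|λ^d_j − λ^d_k| ≤ Σ(μ), where both sides take values in [−∞, ∞). -/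
open MeasureTheory Filter Set
open scoped ENNReal NNReal Topology BigOperators

noncomputable section

/-- Integration against the empirical measure is averaging. -/
lemma integral_empMeasure (d : ℕ) (l : Fin d → ℂ) (f : ℂ → ℝ) :
    ∫ z, f z ∂(empMeasure d l) = (d : ℝ)⁻¹ * ∑ j, f (l j) := by
  rw [empMeasure, integral_smul_measure, integral_finsetSum_measure]
  · simp
  · intro j _
    exact integrable_dirac (by simp)

lemma isProbabilityMeasure_empMeasure {d : ℕ} (hd : d ≠ 0) (l : Fin d → ℂ) :
    IsProbabilityMeasure (empMeasure d l) := by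
  constructor
  simp only [empMeasure, Measure.smul_apply, Measure.finsetSum_apply, measure_univ]
  simp [ENNReal.inv_mul_cancel, hd]

/-- Weak convergence of empirical measures passes to product measures. -/
lemma tendsto_average_prod {E : Set ℂ}
    (μ : Measure ℂ) [IsProbabilityMeasure μ] (hμE : μ Eᶜ = 0)
    (lam : (d : ℕ) → Fin d → ℂ)
    (hconv : ∀ f : ℂ → ℝ, ContinuousOn f E →
      Tendsto (fun d : ℕ => (d : ℝ)⁻¹ * ∑ j : Fin d, f (lam d j)) atTop (𝓝 (∫ z in E, f z ∂μ)))
    (f : BoundedContinuousFunction (ℂ × ℂ) ℝ) :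
    Tendsto (fun d : ℕ => ((d : ℝ) ^ 2)⁻¹ * ∑ i, ∑ j, f (lam d i, lam d j)) atTop
      (𝓝 (∫ p, f p ∂(μ.prod μ))) := by
  rw [← tendsto_add_atTop_iff_nat 1]
  let P : ℕ → ProbabilityMeasure ℂ := fun d =>
    ⟨empMeasure (d + 1) (lam (d + 1)), isProbabilityMeasure_empMeasure d.succ_ne_zero _⟩
  let Q : ProbabilityMeasure ℂ := ⟨μ, inferInstance⟩
  have hres : μ.restrict E = μ := Measure.restrict_eq_self_of_ae_mem (mem_ae_iff.2 hμE)
  have hP : Tendsto P atTop (𝓝 Q) := by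
    rw [ProbabilityMeasure.tendsto_iff_forall_integral_tendsto]
    intro g
    have h := hconv g g.continuous.continuousOn
    rw [hres, ← tendsto_add_atTop_iff_nat 1] at h
    simpa only [P, Q, ProbabilityMeasure.coe_mk, integral_empMeasure] using h
  have hPP : Tendsto (fun d => (P d).prod (P d)) atTop (𝓝 (Q.prod Q)) :=
    (ProbabilityMeasure.continuous_prod.tendsto (Q, Q)).comp (hP.prodMk_nhds hP)
  have h := (ProbabilityMeasure.tendsto_iff_forall_integral_tendsto.1 hPP) f
  refine h.congr fun d => ?_
  rw [ProbabilityMeasure.toMeasure_prod, integral_prod _ (f.integrable _)]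
  simp only [P, ProbabilityMeasure.coe_mk, integral_empMeasure]
  rw [← Finset.mul_sum, ← mul_assoc, sq, mul_inv]

/-- The logarithmic kernel, cut off below at level `-n` and above at level `log R`. -/
def logKernel (n : ℕ) (R : ℝ) (p : ℂ × ℂ) : ℝ :=
  Real.log (min (max ‖p.1 - p.2‖ (Real.exp (-n))) R)

lemma neg_le_logKernel (n : ℕ) {R : ℝ} (hR : 1 ≤ R) (p : ℂ × ℂ) : -(n : ℝ) ≤ logKernel n R p := by
  have h1 : Real.exp (-n) ≤ 1 := Real.exp_le_one_iff.2 (by simp)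
  have h : Real.exp (-n) ≤ min (max ‖p.1 - p.2‖ (Real.exp (-n))) R :=
    le_min (le_max_right _ _) (h1.trans hR)
  exact (Real.le_log_iff_exp_le ((Real.exp_pos _).trans_le h)).2 h

lemma min_max_exp_pos (n : ℕ) {R : ℝ} (hR : 1 ≤ R) (x : ℝ) :
    0 < min (max x (Real.exp (-n))) R :=
  lt_min ((Real.exp_pos _).trans_le (le_max_right _ _)) (one_pos.trans_le hR)

lemma logKernel_le (n : ℕ) {R : ℝ} (hR : 1 ≤ R) (p : ℂ × ℂ) : logKernel n R p ≤ Real.log R :=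
  Real.log_le_log (min_max_exp_pos n hR _) (min_le_right _ _)

lemma continuous_logKernel (n : ℕ) {R : ℝ} (hR : 1 ≤ R) : Continuous (logKernel n R) :=
  Continuous.log (by fun_prop) fun _ => (min_max_exp_pos n hR _).ne'

lemma logKernel_self (n : ℕ) {R : ℝ} (hR : 1 ≤ R) (z : ℂ) : logKernel n R (z, z) = -n := by
  have h1 : Real.exp (-n) ≤ 1 := Real.exp_le_one_iff.2 (by simp)
  simp [logKernel, max_eq_right (Real.exp_pos (-(n : ℝ))).le, min_eq_left (h1.trans hR)]

/-- The truncated kernel as a bounded continuous function. -/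
def logKernelBCF (n : ℕ) {R : ℝ} (hR : 1 ≤ R) : BoundedContinuousFunction (ℂ × ℂ) ℝ :=
  BoundedContinuousFunction.ofNormedAddCommGroup (logKernel n R) (continuous_logKernel n hR)
    (max n (Real.log R)) fun p => by
      rw [Real.norm_eq_abs, abs_le]
      exact ⟨(neg_le_neg (le_max_left _ _)).trans (neg_le_logKernel n hR p),
        (logKernel_le n hR p).trans (le_max_right _ _)⟩

lemma elog_le_logKernel (n : ℕ) {R : ℝ} {p : ℂ × ℂ} (hp : ‖p.1 - p.2‖ ≤ R) :
    elog (ENNReal.ofReal ‖p.1 - p.2‖) ≤ (logKernel n R p : EReal) := by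
  rcases (norm_nonneg (p.1 - p.2)).eq_or_lt with h | h
  · simp [elog, ← h]
  · rw [elog, if_neg (by simpa using h), if_neg ENNReal.ofReal_ne_top,
      ENNReal.toReal_ofReal h.le, EReal.coe_le_coe_iff]
    exact Real.log_le_log h (le_min (le_max_left _ _) hp)

lemma ofReal_logKernel (n : ℕ) {R : ℝ} (hR : 1 ≤ R) {p : ℂ × ℂ} (hp : ‖p.1 - p.2‖ ≤ R) :
    ENNReal.ofReal (logKernel n R p) = ENNReal.ofReal (Real.log ‖p.1 - p.2‖) := by
  have h1 : Real.exp (-n) ≤ 1 := Real.exp_le_one_iff.2 (by simp)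
  rcases le_total 1 ‖p.1 - p.2‖ with h | h
  · rw [logKernel, max_eq_left (h1.trans h), min_eq_left hp]
  · rw [ENNReal.ofReal_of_nonpos (Real.log_nonpos (norm_nonneg _) h), ENNReal.ofReal_of_nonpos]
    exact Real.log_nonpos (min_max_exp_pos n hR _).le ((min_le_left _ _).trans (max_le h h1))

lemma min_le_ofReal_neg_logKernel (n : ℕ) {R : ℝ} (hR : 1 ≤ R) (p : ℂ × ℂ) :
    min (ENNReal.ofReal (-Real.log ‖p.1 - p.2‖)) n ≤ ENNReal.ofReal (-logKernel n R p) := by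
  rcases (norm_nonneg (p.1 - p.2)).eq_or_lt with h | h
  · simp [← h]
  · rw [← ENNReal.ofReal_natCast n, ← ENNReal.ofReal_min]
    refine ENNReal.ofReal_le_ofReal ?_
    have hle : logKernel n R p ≤ Real.log (max ‖p.1 - p.2‖ (Real.exp (-n))) :=
      Real.log_le_log (min_max_exp_pos n hR _) (min_le_left _ _)
    rcases le_total ‖p.1 - p.2‖ (Real.exp (-n)) with h2 | h2
    · rw [max_eq_right h2, Real.log_exp] at hle
      exact (min_le_right _ _).trans (by linarith)
    · rw [max_eq_left h2] at hle
      exact (min_le_left _ _).trans (by linarith)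

/-- The discrete off-diagonal energy is bounded by the integral of the truncated kernel. -/
lemma limsup_log_offDiag_le_integral_logKernel {E : Set ℂ}
    (μ : Measure ℂ) [IsProbabilityMeasure μ] (hμE : μ Eᶜ = 0)
    (lam : (d : ℕ) → Fin d → ℂ) (hlam : ∀ d : ℕ, ∀ j, lam d j ∈ E)
    (hconv : ∀ f : ℂ → ℝ, ContinuousOn f E →
      Tendsto (fun d : ℕ => (d : ℝ)⁻¹ * ∑ j : Fin d, f (lam d j)) atTop (𝓝 (∫ z in E, f z ∂μ)))
    (n : ℕ) {R : ℝ} (hR : 1 ≤ R) (hER : ∀ z ∈ E, ∀ t ∈ E, ‖z - t‖ ≤ R) :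
    atTop.limsup
      (fun d : ℕ => ((((d : ℝ) ^ 2)⁻¹ : ℝ) : EReal) *
        ∑ p ∈ (Finset.univ : Finset (Fin d)).offDiag,
          elog (ENNReal.ofReal ‖lam d p.1 - lam d p.2‖))
      ≤ ((∫ p, logKernel n R p ∂(μ.prod μ) : ℝ) : EReal) := by
  have hlim := tendsto_average_prod μ hμE lam hconv (logKernelBCF n hR)
  change Tendsto (fun d : ℕ => ((d : ℝ) ^ 2)⁻¹ * ∑ i, ∑ j, logKernel n R (lam d i, lam d j)) atTop
      (𝓝 (∫ p, logKernel n R p ∂(μ.prod μ))) at hlim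
  have hdiag : Tendsto (fun d : ℕ => (n : ℝ) / d) atTop (𝓝 0) :=
    tendsto_const_div_atTop_nhds_zero_nat _
  have hsum := hlim.add hdiag
  rw [add_zero] at hsum
  have hsum' := (continuous_coe_real_ereal.tendsto _).comp hsum
  refine (limsup_le_limsup ?_).trans_eq hsum'.limsup_eq
  filter_upwards [eventually_ne_atTop 0] with d hd
  have hd' : (d : ℝ) ≠ 0 := Nat.cast_ne_zero.2 hd
  have hle : ∑ p ∈ (Finset.univ : Finset (Fin d)).offDiag,
      elog (ENNReal.ofReal ‖lam d p.1 - lam d p.2‖) ≤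
      ((∑ p ∈ (Finset.univ : Finset (Fin d)).offDiag,
        logKernel n R (lam d p.1, lam d p.2) : ℝ) : EReal) := by
    refine (Finset.sum_le_sum fun p _ => ?_).trans_eq
      (map_sum (⟨⟨Real.toEReal, EReal.coe_zero⟩, EReal.coe_add⟩ : ℝ →+ EReal) _ _).symm
    exact
      elog_le_logKernel n (p := (lam d p.1, lam d p.2)) (hER _ (hlam d _) _ (hlam d _))
  have hsplit : ∑ i, ∑ j, logKernel n R (lam d i, lam d j) =
      -(d * n : ℝ) + ∑ p ∈ (Finset.univ : Finset (Fin d)).offDiag,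
        logKernel n R (lam d p.1, lam d p.2) := by
    rw [← Finset.sum_product', ← Finset.diag_union_offDiag,
      Finset.sum_union (Finset.disjoint_diag_offDiag _), Finset.sum_diag]
    simp [logKernel_self n hR]
  refine (mul_le_mul_of_nonneg_left hle (EReal.coe_nonneg.2 (by positivity))).trans_eq ?_
  rw [← EReal.coe_mul]
  simp only [Function.comp_apply]
  rw [hsplit]
  congr 1
  field_simp
  ring

lemma tendsto_lintegral_min_natCast {α : Type*} [MeasurableSpace α] (ν : Measure α)
    {f : α → ℝ≥0∞} (hf : Measurable f) (hfin : ∀ x, f x ≠ ⊤) :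
    Tendsto (fun n : ℕ => ∫⁻ x, min (f x) n ∂ν) atTop (𝓝 (∫⁻ x, f x ∂ν)) := by
  refine lintegral_tendsto_of_tendsto_of_monotone (fun n => (hf.min measurable_const).aemeasurable)
    (ae_of_all _ fun x m n hmn => min_le_min_left _ (by exact_mod_cast hmn))
    (ae_of_all _ fun x => ?_)
  obtain ⟨N, hN⟩ := ENNReal.exists_nat_gt (hfin x)
  refine tendsto_const_nhds.congr' ?_
  filter_upwards [eventually_ge_atTop N] with n hn
  exact (min_eq_left (hN.le.trans (by exact_mod_cast hn))).symm

/-- The truncated energy is bounded by the positive part of the energy minus the truncated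
negative part. -/
lemma integral_logKernel_le (μ : Measure ℂ) [IsProbabilityMeasure μ]
    (n : ℕ) {R : ℝ} (hR : 1 ≤ R) (hμR : ∀ᵐ p ∂(μ.prod μ), ‖p.1 - p.2‖ ≤ R) :
    ((∫ p, logKernel n R p ∂(μ.prod μ) : ℝ) : EReal) ≤
      (((∫⁻ p : ℂ × ℂ, ENNReal.ofReal (Real.log ‖p.1 - p.2‖) ∂(μ.prod μ)).toReal : ℝ) : EReal) -
      ((∫⁻ p : ℂ × ℂ, min (ENNReal.ofReal (-Real.log ‖p.1 - p.2‖)) n ∂(μ.prod μ) : ℝ≥0∞) :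
        EReal) := by
  have hint : Integrable (logKernel n R) (μ.prod μ) := (logKernelBCF n hR).integrable _
  have hfin : ∫⁻ p, ENNReal.ofReal (-logKernel n R p) ∂(μ.prod μ) ≠ ⊤ :=
    hint.neg.lintegral_lt_top.ne
  rw [integral_eq_lintegral_pos_part_sub_lintegral_neg_part hint, EReal.coe_sub,
    EReal.coe_ennreal_toReal hfin,
    lintegral_congr_ae (hμR.mono fun p hp => ofReal_logKernel n hR hp)]
  refine EReal.sub_le_sub le_rfl (EReal.coe_ennreal_le_coe_ennreal_iff.2 ?_)
  exact lintegral_mono fun p => min_le_ofReal_neg_logKernel n hR p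

/-- the upper semicontinuity bound
`limsup_d (1/d²) Σ_{j≠k} log|λ^d_j − λ^d_k| ≤ Σ(μ)`. -/
theorem limsup_log_offDiag_le_freeEntropy (E : Set ℂ) (hE : IsCompact E)
    (μ : MeasureTheory.Measure ℂ) [MeasureTheory.IsProbabilityMeasure μ] (hμE : μ Eᶜ = 0)
    (lam : (d : ℕ) → Fin d → ℂ) (hlam : ∀ d : ℕ, ∀ j, lam d j ∈ E)
    (hconv : ∀ f : ℂ → ℝ, ContinuousOn f E →
      Filter.Tendsto (fun d : ℕ => (d : ℝ)⁻¹ * ∑ j : Fin d, f (lam d j))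
        Filter.atTop (nhds (∫ z in E, f z ∂μ))) :
    Filter.atTop.limsup
      (fun d : ℕ => ((((d : ℝ) ^ 2)⁻¹ : ℝ) : EReal) *
        ∑ p ∈ (Finset.univ : Finset (Fin d)).offDiag,
          elog (ENNReal.ofReal ‖lam d p.1 - lam d p.2‖)) ≤ freeEntropy μ := by
  obtain ⟨C, hC⟩ := hE.isBounded.exists_norm_le
  have hER : ∀ z ∈ E, ∀ t ∈ E, ‖z - t‖ ≤ max 1 (C + C) := fun z hz t ht =>
    (norm_sub_le z t).trans ((add_le_add (hC z hz) (hC t ht)).trans (le_max_right _ _))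
  have hμR : ∀ᵐ p ∂(μ.prod μ), ‖p.1 - p.2‖ ≤ max 1 (C + C) := by
    have hmem : ∀ᵐ z ∂μ, z ∈ E := mem_ae_iff.2 hμE
    filter_upwards [Measure.quasiMeasurePreserving_fst.ae hmem,
      Measure.quasiMeasurePreserving_snd.ae hmem] with p h1 h2
    exact hER _ h1 _ h2
  have hmeas : Measurable fun p : ℂ × ℂ => ENNReal.ofReal (-Real.log ‖p.1 - p.2‖) := by
    fun_prop
  have hneg := (continuous_coe_ennreal_ereal.tendsto _).comp
    (tendsto_lintegral_min_natCast (μ.prod μ) hmeas fun _ => ENNReal.ofReal_ne_top)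
  have hsub : Continuous fun x : EReal =>
      (((∫⁻ p : ℂ × ℂ, ENNReal.ofReal (Real.log ‖p.1 - p.2‖) ∂(μ.prod μ)).toReal : ℝ) : EReal)
        - x := by
    simp only [sub_eq_add_neg]
    refine continuous_iff_continuousAt.2 fun x => ?_
    exact (EReal.continuousAt_add (Or.inl (EReal.coe_ne_top _)) (Or.inl (EReal.coe_ne_bot _))).comp
      (continuousAt_const.prodMk continuous_neg.continuousAt)
  refine ge_of_tendsto' ((hsub.tendsto _).comp hneg) fun n => ?_
  exact (limsup_log_offDiag_le_integral_logKernel μ hμE lam hlam hconv n (le_max_left _ _)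
    hER).trans (integral_logKernel_le μ n (le_max_left _ _) hμR)

end
end
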